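/- Let (H,R) be a cotriangular Hopf algebra and let I_R := {a ∈ H : R(b,a) = 0 for all b ∈ H} be the right radical of R. Then I_R coincides with the left radical {a ∈ H : R(a,b) = 0 for all b ∈ H}, and I_R is a Hopf ideal of H (a two-sided ideal which is also a coideal and is stable under the antipode). -/

import Mathlib

open TensorProduct

noncomputable section

/-- Convolution product of two `ℂ`-valued functionals on a `ℂ`-coalgebra. -/
def conv {C : Type} [AddCommGroup C] [Module ℂ C] [Coalgebra ℂ C]
    (f g : C →ₗ[ℂ] ℂ) : C →ₗ[ℂ] ℂ :=
  LinearMap.mul' ℂ ℂ ∘ₗ TensorProduct.map f g ∘ₗ Coalgebra.comul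

variable {H : Type} [Ring H] [HopfAlgebra ℂ H]

/-- `ℓ ⊗ g ↦ ε(ℓ) g`. -/
def dropLeft : H ⊗[ℂ] H →ₗ[ℂ] H :=
  (TensorProduct.lid ℂ H).toLinearMap ∘ₗ TensorProduct.map Coalgebra.counit LinearMap.id

/-- `ℓ ⊗ g ↦ ε(g) ℓ`. -/
def dropRight : H ⊗[ℂ] H →ₗ[ℂ] H :=
  (TensorProduct.rid ℂ H).toLinearMap ∘ₗ TensorProduct.map LinearMap.id Coalgebra.counit

/-- An R-form making `H` coquasitriangular: `R` is convolution invertible,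
`R(h, ℓg) = Σ R(h₁,g) R(h₂,ℓ)`, `R(gh, ℓ) = Σ R(g,ℓ₁) R(h,ℓ₂)`, and
`Σ R(h₁,g₁) h₂g₂ = Σ g₁h₁ R(h₂,g₂)`. -/
structure IsRForm (Rf : H ⊗[ℂ] H →ₗ[ℂ] ℂ) : Prop where
  invertible : ∃ Rf' : H ⊗[ℂ] H →ₗ[ℂ] ℂ,
    conv Rf Rf' = Coalgebra.counit ∧ conv Rf' Rf = Coalgebra.counit
  mul_right : Rf ∘ₗ TensorProduct.map LinearMap.id (LinearMap.mul' ℂ H) =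
    conv (Rf ∘ₗ TensorProduct.map LinearMap.id dropLeft)
      (Rf ∘ₗ TensorProduct.map LinearMap.id dropRight)
  mul_left : Rf ∘ₗ TensorProduct.map (LinearMap.mul' ℂ H) LinearMap.id =
    conv (Rf ∘ₗ TensorProduct.map dropRight LinearMap.id)
      (Rf ∘ₗ TensorProduct.map dropLeft LinearMap.id)
  comm_rel : (TensorProduct.lid ℂ H).toLinearMap
        ∘ₗ TensorProduct.map Rf (LinearMap.mul' ℂ H) ∘ₗ Coalgebra.comul =
      (TensorProduct.rid ℂ H).toLinearMap
        ∘ₗ TensorProduct.map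
            (LinearMap.mul' ℂ H ∘ₗ (TensorProduct.comm ℂ H H).toLinearMap) Rf
        ∘ₗ Coalgebra.comul

/-- A cotriangular structure on `H`: an R-form with additionally
`Σ R(h₁,g₁) R(g₂,h₂) = ε(g) ε(h)`, i.e. `R⁻¹ = R₂₁`. -/
structure IsCotriangular (Rf : H ⊗[ℂ] H →ₗ[ℂ] ℂ) extends IsRForm Rf : Prop where
  symm : conv Rf (Rf ∘ₗ (TensorProduct.comm ℂ H H).toLinearMap) = Coalgebra.counit

/-- The right radical `I_R = {a : ∀ b, R(b, a) = 0}` of a bilinear form, as a subspace. -/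
def rad (Rf : H ⊗[ℂ] H →ₗ[ℂ] ℂ) : Submodule ℂ H where
  carrier := {a | ∀ b : H, Rf (b ⊗ₜ[ℂ] a) = 0}
  zero_mem' := by intro b; simp
  add_mem' := by
    intro x y hx hy b
    simp [TensorProduct.tmul_add, hx b, hy b]
  smul_mem' := by
    intro c x hx b
    rw [TensorProduct.tmul_smul, map_smul, hx b, smul_zero]

/-- The linear map `a ↦ Σ m (φ a₁) (ψ a₂)`. -/
def sweedler {X Y U : Type} [AddCommGroup X] [Module ℂ X] [AddCommGroup Y] [Module ℂ Y]
    [AddCommGroup U] [Module ℂ U] (m : X →ₗ[ℂ] Y →ₗ[ℂ] U) (φ : H →ₗ[ℂ] X) (ψ : H →ₗ[ℂ] Y) :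
    H →ₗ[ℂ] U :=
  TensorProduct.lift (m.compl₁₂ φ ψ) ∘ₗ Coalgebra.comul

section Sweedler

variable {X Y Z U V W : Type} [AddCommGroup X] [Module ℂ X] [AddCommGroup Y] [Module ℂ Y]
  [AddCommGroup Z] [Module ℂ Z] [AddCommGroup U] [Module ℂ U] [AddCommGroup V] [Module ℂ V]
  [AddCommGroup W] [Module ℂ W]

theorem sweedler_apply (m : X →ₗ[ℂ] Y →ₗ[ℂ] U) (φ : H →ₗ[ℂ] X) (ψ : H →ₗ[ℂ] Y) (a : H) :
    sweedler m φ ψ a = TensorProduct.lift (m.compl₁₂ φ ψ) (Coalgebra.comul (R := ℂ) a) := rfl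

theorem sweedler_congr {m : X →ₗ[ℂ] Y →ₗ[ℂ] U} {φ : H →ₗ[ℂ] X} {ψ : H →ₗ[ℂ] Y}
    {m' : Z →ₗ[ℂ] W →ₗ[ℂ] U} {φ' : H →ₗ[ℂ] Z} {ψ' : H →ₗ[ℂ] W}
    (h : ∀ x y, m (φ x) (ψ y) = m' (φ' x) (ψ' y)) :
    sweedler m φ ψ = sweedler m' φ' ψ' := by
  unfold sweedler
  congr 1
  ext x y
  exact h x y

theorem comp_sweedler (T : U →ₗ[ℂ] V) {m : X →ₗ[ℂ] Y →ₗ[ℂ] U} {φ : H →ₗ[ℂ] X}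
    {ψ : H →ₗ[ℂ] Y} {m' : Z →ₗ[ℂ] W →ₗ[ℂ] V} {φ' : H →ₗ[ℂ] Z} {ψ' : H →ₗ[ℂ] W}
    (h : ∀ x y, T (m (φ x) (ψ y)) = m' (φ' x) (ψ' y)) :
    T ∘ₗ sweedler m φ ψ = sweedler m' φ' ψ' := by
  unfold sweedler
  rw [← LinearMap.comp_assoc]
  congr 1
  ext x y
  exact h x y

theorem map_sweedler_eq_zero (T : U →ₗ[ℂ] V) {m : X →ₗ[ℂ] Y →ₗ[ℂ] U} {φ : H →ₗ[ℂ] X}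
    {ψ : H →ₗ[ℂ] Y} (h : ∀ x y, T (m (φ x) (ψ y)) = 0) (a : H) :
    T (sweedler m φ ψ a) = 0 := by
  have h' : T ∘ₗ TensorProduct.lift (m.compl₁₂ φ ψ) = 0 := by
    ext x y
    exact h x y
  exact LinearMap.congr_fun h' _

theorem sweedler_assoc {m₁ : X →ₗ[ℂ] Y →ₗ[ℂ] U} {m₂ : U →ₗ[ℂ] Z →ₗ[ℂ] V}
    {m₃ : Y →ₗ[ℂ] Z →ₗ[ℂ] W} {m₄ : X →ₗ[ℂ] W →ₗ[ℂ] V}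
    {φ : H →ₗ[ℂ] X} {ψ : H →ₗ[ℂ] Y} {χ : H →ₗ[ℂ] Z}
    (h : ∀ x y z, m₂ (m₁ (φ x) (ψ y)) (χ z) = m₄ (φ x) (m₃ (ψ y) (χ z))) :
    sweedler m₂ (sweedler m₁ φ ψ) χ = sweedler m₄ φ (sweedler m₃ ψ χ) := by
  have key : TensorProduct.lift (m₂.compl₁₂ (TensorProduct.lift (m₁.compl₁₂ φ ψ)) χ) =
      TensorProduct.lift (m₄.compl₁₂ φ (TensorProduct.lift (m₃.compl₁₂ ψ χ))) ∘ₗ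
        (TensorProduct.assoc ℂ H H H).toLinearMap := by
    ext x y z
    exact h x y z
  have hl : sweedler m₂ (sweedler m₁ φ ψ) χ =
      TensorProduct.lift (m₂.compl₁₂ (TensorProduct.lift (m₁.compl₁₂ φ ψ)) χ) ∘ₗ
        Coalgebra.comul.rTensor H ∘ₗ Coalgebra.comul := by
    unfold sweedler
    rw [← LinearMap.comp_assoc]
    congr 1
    ext x y
    simp
  have hr : sweedler m₄ φ (sweedler m₃ ψ χ) =
      TensorProduct.lift (m₄.compl₁₂ φ (TensorProduct.lift (m₃.compl₁₂ ψ χ))) ∘ₗ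
        Coalgebra.comul.lTensor H ∘ₗ Coalgebra.comul := by
    unfold sweedler
    rw [← LinearMap.comp_assoc]
    congr 1
    ext x y
    simp
  rw [hl, hr, key, LinearMap.comp_assoc, ← Coalgebra.coassoc]

theorem sweedler_counit_left {m : X →ₗ[ℂ] Y →ₗ[ℂ] U} {φ : H →ₗ[ℂ] X} {ψ : H →ₗ[ℂ] Y} (x₀ : X)
    (h : ∀ a, φ a = Coalgebra.counit (R := ℂ) a • x₀) :
    sweedler m φ ψ = m x₀ ∘ₗ ψ := by
  have key : TensorProduct.lift (m.compl₁₂ φ ψ) =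
      TensorProduct.lift ((LinearMap.lsmul ℂ U).compl₁₂ LinearMap.id (m x₀ ∘ₗ ψ)) ∘ₗ
        Coalgebra.counit.rTensor H := by
    ext x y
    simp [h]
  ext a
  rw [sweedler_apply, key, LinearMap.comp_apply, Coalgebra.rTensor_counit_comul]
  simp

theorem sweedler_counit_right {m : X →ₗ[ℂ] Y →ₗ[ℂ] U} {φ : H →ₗ[ℂ] X} {ψ : H →ₗ[ℂ] Y} (y₀ : Y)
    (h : ∀ a, ψ a = Coalgebra.counit (R := ℂ) a • y₀) :
    sweedler m φ ψ = m.flip y₀ ∘ₗ φ := by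
  have key : TensorProduct.lift (m.compl₁₂ φ ψ) =
      TensorProduct.lift ((LinearMap.lsmul ℂ U).flip.compl₁₂ (m.flip y₀ ∘ₗ φ) LinearMap.id) ∘ₗ
        Coalgebra.counit.lTensor H := by
    ext x y
    simp [h]
  ext a
  rw [sweedler_apply, key, LinearMap.comp_apply, Coalgebra.lTensor_counit_comul]
  simp

theorem sweedler_mk : sweedler (TensorProduct.mk ℂ H H) LinearMap.id LinearMap.id =
    Coalgebra.comul (R := ℂ) := by
  have h : TensorProduct.lift ((TensorProduct.mk ℂ H H).compl₁₂ LinearMap.id LinearMap.id) =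
      LinearMap.id := by
    ext x y
    rfl
  rw [sweedler, h, LinearMap.id_comp]

theorem sweedler_antipode_id :
    sweedler (LinearMap.mul ℂ H) (HopfAlgebra.antipode ℂ) LinearMap.id =
      Algebra.linearMap ℂ H ∘ₗ Coalgebra.counit := by
  rw [← HopfAlgebra.mul_antipode_rTensor_comul, ← LinearMap.comp_assoc]
  unfold sweedler
  congr 1
  ext x y
  rfl

theorem sweedler_id_antipode :
    sweedler (LinearMap.mul ℂ H) LinearMap.id (HopfAlgebra.antipode ℂ) =
      Algebra.linearMap ℂ H ∘ₗ Coalgebra.counit := by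
  rw [← HopfAlgebra.mul_antipode_lTensor_comul, ← LinearMap.comp_assoc]
  unfold sweedler
  congr 1
  ext x y
  rfl

/-- If `m (φ x) (ψ y) = T (S(x) y)`, then `Σ m (φ a₁) (ψ a₂) = ε(a) T(1)`. -/
theorem sweedler_of_antipode_mul (T : H →ₗ[ℂ] U) {m : X →ₗ[ℂ] Y →ₗ[ℂ] U} {φ : H →ₗ[ℂ] X}
    {ψ : H →ₗ[ℂ] Y} (h : ∀ x y, m (φ x) (ψ y) = T (HopfAlgebra.antipode ℂ x * y)) (a : H) :
    sweedler m φ ψ a = Coalgebra.counit (R := ℂ) a • T 1 := by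
  rw [← comp_sweedler T (m := LinearMap.mul ℂ H) (φ := HopfAlgebra.antipode ℂ)
    (ψ := LinearMap.id) (fun x y => (h x y).symm), sweedler_antipode_id]
  simp [Algebra.algebraMap_eq_smul_one]

/-- If `m (φ x) (ψ y) = T (x S(y))`, then `Σ m (φ a₁) (ψ a₂) = ε(a) T(1)`. -/
theorem sweedler_of_mul_antipode (T : H →ₗ[ℂ] U) {m : X →ₗ[ℂ] Y →ₗ[ℂ] U} {φ : H →ₗ[ℂ] X}
    {ψ : H →ₗ[ℂ] Y} (h : ∀ x y, m (φ x) (ψ y) = T (x * HopfAlgebra.antipode ℂ y)) (a : H) :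
    sweedler m φ ψ a = Coalgebra.counit (R := ℂ) a • T 1 := by
  rw [← comp_sweedler T (m := LinearMap.mul ℂ H) (φ := LinearMap.id)
    (ψ := HopfAlgebra.antipode ℂ) (fun x y => (h x y).symm), sweedler_id_antipode]
  simp [Algebra.algebraMap_eq_smul_one]

end Sweedler

theorem apply_comul_tmul {C D U : Type} [AddCommGroup C] [Module ℂ C] [Coalgebra ℂ C]
    [AddCommGroup D] [Module ℂ D] [Coalgebra ℂ D] [AddCommGroup U] [Module ℂ U]
    {T : (C ⊗[ℂ] D) ⊗[ℂ] (C ⊗[ℂ] D) →ₗ[ℂ] U} (m : C ⊗[ℂ] C →ₗ[ℂ] D ⊗[ℂ] D →ₗ[ℂ] U)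
    (hm : ∀ (x y : C) (z w : D), T ((x ⊗ₜ z) ⊗ₜ (y ⊗ₜ w)) = m (x ⊗ₜ y) (z ⊗ₜ w)) (c : C) (d : D) :
    T (Coalgebra.comul (R := ℂ) (c ⊗ₜ[ℂ] d)) =
      m (Coalgebra.comul (R := ℂ) c) (Coalgebra.comul (R := ℂ) d) := by
  have key : T ∘ₗ (TensorProduct.tensorTensorTensorComm ℂ C C D D).toLinearMap =
      TensorProduct.lift m := by
    apply TensorProduct.ext_fourfold'
    intro x y z w
    simp [hm]
  rw [TensorProduct.comul_tmul]
  exact LinearMap.congr_fun key (_ ⊗ₜ _)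

theorem dropLeft_comul (a : H) : dropLeft (Coalgebra.comul (R := ℂ) a) = a := by
  have h := Coalgebra.rTensor_counit_comul (R := ℂ) a
  rw [LinearMap.rTensor] at h
  simp [dropLeft, h]

theorem dropRight_comul (a : H) : dropRight (Coalgebra.comul (R := ℂ) a) = a := by
  have h := Coalgebra.lTensor_counit_comul (R := ℂ) a
  rw [LinearMap.lTensor] at h
  simp [dropRight, h]

theorem map_dropLeft_dropRight_comul (a b : H) :
    TensorProduct.map dropLeft dropRight (Coalgebra.comul (R := ℂ) (a ⊗ₜ[ℂ] b)) = b ⊗ₜ a := by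
  rw [apply_comul_tmul ((TensorProduct.mk ℂ H H).compl₁₂ dropRight dropLeft).flip
    (fun x y z w => by
      simp [dropLeft, dropRight, TensorProduct.smul_tmul', TensorProduct.tmul_smul,
        smul_smul, mul_comm])]
  simp [dropLeft_comul, dropRight_comul]

theorem map_dropRight_dropLeft_comul (a b : H) :
    TensorProduct.map dropRight dropLeft (Coalgebra.comul (R := ℂ) (a ⊗ₜ[ℂ] b)) = a ⊗ₜ b := by
  rw [apply_comul_tmul ((TensorProduct.mk ℂ H H).compl₁₂ dropRight dropLeft)
    (fun x y z w => by
      simp [dropLeft, dropRight, TensorProduct.smul_tmul', TensorProduct.tmul_smul,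
        smul_smul, mul_comm])]
  simp [dropLeft_comul, dropRight_comul]

/-- The bilinear form `(h, g) ↦ R(h, g)`. -/
def form (Rf : H ⊗[ℂ] H →ₗ[ℂ] ℂ) : H →ₗ[ℂ] H →ₗ[ℂ] ℂ := TensorProduct.curry Rf

@[simp]
theorem form_apply (Rf : H ⊗[ℂ] H →ₗ[ℂ] ℂ) (h g : H) : form Rf h g = Rf (h ⊗ₜ g) := rfl

/-- The convolution product of functionals on `H`, as a bilinear map. -/
def convBilin : (H →ₗ[ℂ] ℂ) →ₗ[ℂ] (H →ₗ[ℂ] ℂ) →ₗ[ℂ] (H →ₗ[ℂ] ℂ) :=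
  LinearMap.mk₂ ℂ (sweedler (LinearMap.mul ℂ ℂ))
    (fun f f' g => by
      simp only [sweedler, ← LinearMap.add_comp]
      congr 1
      ext x y
      simp)
    (fun c f g => by
      simp only [sweedler, ← LinearMap.smul_comp]
      congr 1
      ext x y
      simp [mul_assoc])
    (fun f g g' => by
      simp only [sweedler, ← LinearMap.add_comp]
      congr 1
      ext x y
      simp [mul_add])
    (fun c f g => by
      simp only [sweedler, ← LinearMap.smul_comp]
      congr 1
      ext x y
      simp [mul_left_comm])

@[simp]
theorem convBilin_apply (f g : H →ₗ[ℂ] ℂ) :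
    convBilin f g = sweedler (LinearMap.mul ℂ ℂ) f g := rfl

/-- The form `(x ⊗ y, z ⊗ w) ↦ R(x, z) R(y, w)`. -/
def formSq (Rf : H ⊗[ℂ] H →ₗ[ℂ] ℂ) : H ⊗[ℂ] H →ₗ[ℂ] H ⊗[ℂ] H →ₗ[ℂ] ℂ :=
  (TensorProduct.map₂ (form Rf) (form Rf)).compr₂ (LinearMap.mul' ℂ ℂ)

theorem formSq_tmul (Rf : H ⊗[ℂ] H →ₗ[ℂ] ℂ) (x y z w : H) :
    formSq Rf (x ⊗ₜ y) (z ⊗ₜ w) = Rf (x ⊗ₜ z) * Rf (y ⊗ₜ w) := by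
  simp [formSq]

variable {Rf : H ⊗[ℂ] H →ₗ[ℂ] ℂ}

theorem IsRForm.flip_form_mul (hR : IsRForm Rf) (l g : H) :
    (form Rf).flip (l * g) =
      sweedler (LinearMap.mul ℂ ℂ) ((form Rf).flip g) ((form Rf).flip l) := by
  ext h
  have h₁ := LinearMap.congr_fun hR.mul_right (h ⊗ₜ (l ⊗ₜ g))
  have h₂ : sweedler (LinearMap.mul ℂ ℂ) ((form Rf).flip g) ((form Rf).flip l) =
      (formSq Rf).flip (g ⊗ₜ l) ∘ₗ Coalgebra.comul := by
    unfold sweedler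
    congr 1
    ext x y
    simp [formSq_tmul]
  rw [h₂]
  simp only [conv, LinearMap.comp_apply, TensorProduct.map_tmul, LinearMap.mul'_apply,
    LinearMap.id_apply] at h₁
  refine h₁.trans ?_
  rw [← LinearMap.comp_apply, apply_comul_tmul ((formSq Rf).compl₂
    (TensorProduct.map dropLeft dropRight)) (fun x y z w => by simp [formSq_tmul]),
    LinearMap.compl₂_apply, map_dropLeft_dropRight_comul]
  rfl

theorem IsRForm.form_mul (hR : IsRForm Rf) (g h : H) :
    form Rf (g * h) = sweedler (LinearMap.mul ℂ ℂ) (form Rf g) (form Rf h) := by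
  ext l
  have h₁ := LinearMap.congr_fun hR.mul_left ((g ⊗ₜ h) ⊗ₜ l)
  have h₂ : sweedler (LinearMap.mul ℂ ℂ) (form Rf g) (form Rf h) =
      formSq Rf (g ⊗ₜ h) ∘ₗ Coalgebra.comul := by
    unfold sweedler
    congr 1
    ext x y
    simp [formSq_tmul]
  rw [h₂]
  simp only [conv, LinearMap.comp_apply, TensorProduct.map_tmul, LinearMap.mul'_apply,
    LinearMap.id_apply] at h₁
  refine h₁.trans ?_
  rw [← LinearMap.comp_apply, apply_comul_tmul ((formSq Rf).comp
    (TensorProduct.map dropRight dropLeft)) (fun x y z w => by simp [formSq_tmul]),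
    LinearMap.comp_apply, map_dropRight_dropLeft_comul]
  rfl

theorem IsCotriangular.sweedler_form_flip (hR : IsCotriangular Rf) (h : H) :
    sweedler convBilin (form Rf) (form Rf).flip h =
      Coalgebra.counit (R := ℂ) h • Coalgebra.counit := by
  ext g
  have h₁ := LinearMap.congr_fun hR.symm (h ⊗ₜ g)
  simp only [conv, ← LinearMap.comp_assoc] at h₁
  have h₂ : TensorProduct.lift (convBilin.compl₁₂ (form Rf) (form Rf).flip) =
      LinearMap.lcomp ℂ ℂ Coalgebra.comul ∘ₗ
      (TensorProduct.map₂ (form Rf) (form Rf).flip).compr₂ (LinearMap.mul' ℂ ℂ) := by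
    ext x y z
    simp only [TensorProduct.AlgebraTensorModule.curry_apply, LinearMap.restrictScalars_self,
      TensorProduct.curry_apply, TensorProduct.lift.tmul, LinearMap.compl₁₂_apply,
      convBilin_apply, LinearMap.comp_apply, sweedler_apply, LinearMap.lcomp_apply]
    congr 1
    ext u v
    simp
  rw [LinearMap.comp_apply, apply_comul_tmul ((TensorProduct.map₂ (form Rf) (form Rf).flip).compr₂
    (LinearMap.mul' ℂ ℂ)) (fun x y z w => by simp)] at h₁
  rw [sweedler_apply, h₂]
  simpa [mul_comm] using h₁

theorem IsCotriangular.form_one (hR : IsCotriangular Rf) :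
    form Rf 1 = Coalgebra.counit := by
  have h₁ := hR.sweedler_form_flip (1 : H)
  rw [sweedler_apply, Bialgebra.comul_one, Algebra.TensorProduct.one_def] at h₁
  simp only [TensorProduct.lift.tmul, LinearMap.compl₁₂_apply, convBilin_apply,
    Bialgebra.counit_one, one_smul] at h₁
  have h₂ := hR.form_mul 1 1
  rw [mul_one] at h₂
  have h₃ : sweedler (LinearMap.mul ℂ ℂ) (form Rf 1) Coalgebra.counit = form Rf 1 := by
    rw [sweedler_counit_right 1 (fun a => by simp)]
    ext
    simp
  rw [← h₃, ← h₁, ← sweedler_assoc (m₁ := LinearMap.mul ℂ ℂ) (m₂ := LinearMap.mul ℂ ℂ)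
    (fun x y z => by simp [mul_assoc]), ← h₂]

/-- `R(S(h), g) = R(g, h)`. -/
theorem IsCotriangular.form_antipode (hR : IsCotriangular Rf) :
    form Rf ∘ₗ HopfAlgebra.antipode ℂ = (form Rf).flip := by
  have h₁ : sweedler convBilin (form Rf ∘ₗ HopfAlgebra.antipode ℂ)
      (sweedler convBilin (form Rf) (form Rf).flip) = form Rf ∘ₗ HopfAlgebra.antipode ℂ := by
    rw [sweedler_counit_right _ hR.sweedler_form_flip]
    ext h g
    simp only [LinearMap.comp_apply, LinearMap.flip_apply, convBilin_apply]
    rw [sweedler_counit_right 1 (fun a => by simp)]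
    simp
  rw [← h₁, ← sweedler_assoc (m₁ := convBilin) (m₂ := convBilin),
    sweedler_counit_left (Coalgebra.counit : H →ₗ[ℂ] ℂ)]
  · ext h g
    simp only [LinearMap.comp_apply, convBilin_apply]
    rw [sweedler_counit_left 1 (fun a => by simp)]
    simp
  · intro a
    rw [sweedler_of_antipode_mul (form Rf) (fun x y => by simp [hR.form_mul]), hR.form_one]
  · intro x y z
    exact sweedler_assoc (fun _ _ _ => by simp [mul_assoc])

theorem IsCotriangular.flip_form_one (hR : IsCotriangular Rf) :
    (form Rf).flip 1 = Coalgebra.counit := by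
  rw [← hR.form_antipode, LinearMap.comp_apply, HopfAlgebra.antipode_one, hR.form_one]

/-- The map `f ↦ (x ⊗ y ↦ f(x) y)`. -/
def evalLeft : (H →ₗ[ℂ] ℂ) →ₗ[ℂ] H ⊗[ℂ] H →ₗ[ℂ] H :=
  LinearMap.llcomp ℂ _ _ _ (TensorProduct.lid ℂ H).toLinearMap ∘ₗ LinearMap.rTensorHom H

@[simp]
theorem evalLeft_tmul (f : H →ₗ[ℂ] ℂ) (x y : H) : evalLeft f (x ⊗ₜ y) = f x • y := by
  simp [evalLeft]

/-- The map `f ↦ (x ⊗ y ↦ f(y) x)`. -/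
def evalRight : (H →ₗ[ℂ] ℂ) →ₗ[ℂ] H ⊗[ℂ] H →ₗ[ℂ] H :=
  LinearMap.llcomp ℂ _ _ _ (TensorProduct.rid ℂ H).toLinearMap ∘ₗ LinearMap.lTensorHom H

@[simp]
theorem evalRight_tmul (f : H →ₗ[ℂ] ℂ) (x y : H) : evalRight f (x ⊗ₜ y) = f y • x := by
  simp [evalRight]

/-- The action `f ↦ (h ↦ Σ f(h₁) h₂)` of functionals on `H`. -/
def hitLeft : (H →ₗ[ℂ] ℂ) →ₗ[ℂ] Module.End ℂ H :=
  LinearMap.lcomp ℂ H Coalgebra.comul ∘ₗ evalLeft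

/-- The action `f ↦ (h ↦ Σ f(h₂) h₁)` of functionals on `H`. -/
def hitRight : (H →ₗ[ℂ] ℂ) →ₗ[ℂ] Module.End ℂ H :=
  LinearMap.lcomp ℂ H Coalgebra.comul ∘ₗ evalRight

theorem hitLeft_eq_sweedler (f : H →ₗ[ℂ] ℂ) :
    hitLeft f = sweedler (LinearMap.lsmul ℂ H) f LinearMap.id := by
  change evalLeft f ∘ₗ Coalgebra.comul = _
  unfold sweedler
  congr 1
  ext x y
  simp

theorem hitRight_eq_sweedler (f : H →ₗ[ℂ] ℂ) :
    hitRight f = sweedler (LinearMap.lsmul ℂ H).flip LinearMap.id f := by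
  change evalRight f ∘ₗ Coalgebra.comul = _
  unfold sweedler
  congr 1
  ext x y
  simp

theorem hitLeft_counit : hitLeft (Coalgebra.counit : H →ₗ[ℂ] ℂ) = 1 := by
  rw [hitLeft_eq_sweedler, sweedler_counit_left 1 (fun a => by simp)]
  ext
  simp

theorem hitRight_counit : hitRight (Coalgebra.counit : H →ₗ[ℂ] ℂ) = 1 := by
  rw [hitRight_eq_sweedler, sweedler_counit_right 1 (fun a => by simp)]
  ext
  simp

theorem hitLeft_sweedler (f g : H →ₗ[ℂ] ℂ) :
    hitLeft (sweedler (LinearMap.mul ℂ ℂ) f g) = hitLeft g * hitLeft f := by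
  rw [hitLeft_eq_sweedler, sweedler_assoc (m₃ := LinearMap.lsmul ℂ H)
    (m₄ := LinearMap.lsmul ℂ H) (fun x y z => by simp [smul_smul, mul_comm]), ← hitLeft_eq_sweedler g,
    hitLeft_eq_sweedler f, Module.End.mul_eq_comp]
  exact (comp_sweedler (hitLeft g) (fun x y => by simp)).symm

theorem hitRight_sweedler (f g : H →ₗ[ℂ] ℂ) :
    hitRight (sweedler (LinearMap.mul ℂ ℂ) f g) = hitRight f * hitRight g := by
  rw [hitRight_eq_sweedler, ← sweedler_assoc (m₁ := (LinearMap.lsmul ℂ H).flip)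
    (m₂ := (LinearMap.lsmul ℂ H).flip) (fun x y z => by simp [smul_smul]),
    ← hitRight_eq_sweedler f, hitRight_eq_sweedler g, Module.End.mul_eq_comp]
  exact (comp_sweedler (hitRight f) (fun x y => by simp)).symm

theorem hitLeft_mul_hitRight (f g : H →ₗ[ℂ] ℂ) :
    hitLeft f * hitRight g = hitRight g * hitLeft f := by
  have h : hitLeft f * hitRight g =
      sweedler (LinearMap.lsmul ℂ H).flip (hitLeft f) g := by
    rw [hitRight_eq_sweedler g]
    exact comp_sweedler (hitLeft f) (fun x y => by simp)
  have h' : hitRight g * hitLeft f =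
      sweedler (LinearMap.lsmul ℂ H) f (hitRight g) := by
    rw [hitLeft_eq_sweedler f]
    exact comp_sweedler (hitRight g) (fun x y => by simp)
  rw [h, h', hitLeft_eq_sweedler, hitRight_eq_sweedler]
  exact sweedler_assoc (fun x y z => by simp [smul_smul, mul_comm])

/-- The operators `P_g : h ↦ Σ R(h₁, g) h₂`. -/
def opLeft (Rf : H ⊗[ℂ] H →ₗ[ℂ] ℂ) : H →ₗ[ℂ] Module.End ℂ H := hitLeft ∘ₗ (form Rf).flip

/-- The operators `Q_g : h ↦ Σ h₁ R(h₂, g)`. -/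
def opRight (Rf : H ⊗[ℂ] H →ₗ[ℂ] ℂ) : H →ₗ[ℂ] Module.End ℂ H := hitRight ∘ₗ (form Rf).flip

theorem opLeft_mul_opRight (g l : H) :
    opLeft Rf g * opRight Rf l = opRight Rf l * opLeft Rf g :=
  hitLeft_mul_hitRight _ _

theorem IsRForm.opLeft_mul (hR : IsRForm Rf) (g l : H) :
    opLeft Rf (g * l) = opLeft Rf g * opLeft Rf l := by
  simp only [opLeft, LinearMap.comp_apply, hR.flip_form_mul, hitLeft_sweedler]

theorem IsRForm.opRight_mul (hR : IsRForm Rf) (g l : H) :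
    opRight Rf (g * l) = opRight Rf l * opRight Rf g := by
  simp only [opRight, LinearMap.comp_apply, hR.flip_form_mul, hitRight_sweedler]

theorem IsCotriangular.opLeft_one (hR : IsCotriangular Rf) : opLeft Rf 1 = 1 := by
  rw [opLeft, LinearMap.comp_apply, hR.flip_form_one, hitLeft_counit]

theorem IsCotriangular.opRight_one (hR : IsCotriangular Rf) : opRight Rf 1 = 1 := by
  rw [opRight, LinearMap.comp_apply, hR.flip_form_one, hitRight_counit]

/-- The left multiplication operators `h ↦ x h`. -/
def mulLeftHom : H →ₗ[ℂ] Module.End ℂ H := LinearMap.mul ℂ H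

/-- The right multiplication operators `h ↦ h x`. -/
def mulRightHom : H →ₗ[ℂ] Module.End ℂ H := (LinearMap.mul ℂ H).flip

@[simp]
theorem mulLeftHom_apply (x y : H) : mulLeftHom x y = x * y := rfl

@[simp]
theorem mulRightHom_apply (x y : H) : mulRightHom x y = y * x := rfl

theorem mulLeftHom_mul_mulRightHom (x y : H) :
    mulLeftHom x * mulRightHom y = mulRightHom y * mulLeftHom x := by
  ext z
  simp [mul_assoc]

/-- `Σ R(h₁, g₁) h₂ g₂ = Σ g₁ h₁ R(h₂, g₂)` as an identity of operators in `h`. -/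
theorem IsRForm.sweedler_opLeft_mulRightHom (hR : IsRForm Rf) :
    sweedler (LinearMap.mul ℂ (Module.End ℂ H)).flip (opLeft Rf) mulRightHom =
      sweedler (LinearMap.mul ℂ (Module.End ℂ H)) mulLeftHom (opRight Rf) := by
  ext g h
  have h₁ := LinearMap.congr_fun hR.comm_rel (h ⊗ₜ g)
  have hl : TensorProduct.lift ((LinearMap.mul ℂ (Module.End ℂ H)).flip.compl₁₂
      (opLeft Rf) mulRightHom) = LinearMap.lcomp ℂ H Coalgebra.comul ∘ₗ
        TensorProduct.lift ((LinearMap.llcomp ℂ (H ⊗[ℂ] H) H H).flip.compl₁₂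
          (evalLeft ∘ₗ (form Rf).flip) mulRightHom) := by
    ext x y z
    rfl
  have hr : TensorProduct.lift ((LinearMap.mul ℂ (Module.End ℂ H)).compl₁₂
      mulLeftHom (opRight Rf)) = LinearMap.lcomp ℂ H Coalgebra.comul ∘ₗ
        TensorProduct.lift ((LinearMap.llcomp ℂ (H ⊗[ℂ] H) H H).compl₁₂
          mulLeftHom (evalRight ∘ₗ (form Rf).flip)) := by
    ext x y z
    rfl
  simp only [← LinearMap.comp_assoc] at h₁
  rw [LinearMap.comp_apply,
    apply_comul_tmul (TensorProduct.lift ((LinearMap.llcomp ℂ (H ⊗[ℂ] H) H H).flip.compl₁₂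
      (evalLeft ∘ₗ (form Rf).flip) mulRightHom)).flip (fun x y z w => by simp),
    LinearMap.comp_apply,
    apply_comul_tmul (TensorProduct.lift ((LinearMap.llcomp ℂ (H ⊗[ℂ] H) H H).compl₁₂
      mulLeftHom (evalRight ∘ₗ (form Rf).flip))).flip (fun x y z w => by simp)] at h₁
  rw [sweedler_apply, sweedler_apply, hl, hr]
  exact h₁

/-- `Σ S(a₁) R(h₁, a₂) h₂ = Σ h₁ R(h₂, a₁) S(a₂)` as operators in `h`. -/
theorem IsRForm.sweedler_mulLeftHom_antipode_opLeft (hR : IsRForm Rf) :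
    sweedler (LinearMap.mul ℂ (Module.End ℂ H)) (mulLeftHom ∘ₗ HopfAlgebra.antipode ℂ)
        (opLeft Rf) =
      sweedler (LinearMap.mul ℂ (Module.End ℂ H)).flip (opRight Rf)
        (mulRightHom ∘ₗ HopfAlgebra.antipode ℂ) := by
  have h₁ : opRight Rf = sweedler (LinearMap.mul ℂ (Module.End ℂ H))
      (mulLeftHom ∘ₗ HopfAlgebra.antipode ℂ)
      (sweedler (LinearMap.mul ℂ (Module.End ℂ H)) mulLeftHom (opRight Rf)) := by
    rw [← sweedler_assoc (m₁ := LinearMap.mul ℂ _) (m₂ := LinearMap.mul ℂ _)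
      (fun x y z => by simp [mul_assoc]), sweedler_counit_left (mulLeftHom 1) (fun a =>
        sweedler_of_antipode_mul mulLeftHom (fun x y => by ext; simp [mul_assoc]) a)]
    ext
    simp
  have h₂ : opRight Rf = sweedler (LinearMap.mul ℂ (Module.End ℂ H)).flip
      (sweedler (LinearMap.mul ℂ (Module.End ℂ H)) (mulLeftHom ∘ₗ HopfAlgebra.antipode ℂ)
        (opLeft Rf)) mulRightHom := by
    rw [sweedler_assoc (m₃ := (LinearMap.mul ℂ (Module.End ℂ H)).flip)
      (m₄ := LinearMap.mul ℂ _), hR.sweedler_opLeft_mulRightHom, ← h₁]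
    intro x y z
    simp only [LinearMap.flip_apply, LinearMap.mul_apply', LinearMap.comp_apply]
    rw [← mul_assoc, ← mulLeftHom_mul_mulRightHom, mul_assoc]
  conv_rhs =>
    rw [h₂, sweedler_assoc (m₃ := (LinearMap.mul ℂ (Module.End ℂ H)).flip)
      (m₄ := (LinearMap.mul ℂ (Module.End ℂ H)).flip) (fun x y z => by simp [mul_assoc]),
      sweedler_counit_right (mulRightHom 1) (fun a =>
        sweedler_of_mul_antipode mulRightHom (fun x y => by ext; simp [mul_assoc]) a)]
  ext
  simp

theorem IsCotriangular.mulLeftHom_antipode (hR : IsCotriangular Rf) :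
    mulLeftHom ∘ₗ HopfAlgebra.antipode ℂ =
      sweedler (LinearMap.mul ℂ (Module.End ℂ H)).flip (opRight Rf)
        (sweedler (LinearMap.mul ℂ (Module.End ℂ H)) (mulRightHom ∘ₗ HopfAlgebra.antipode ℂ)
          (opLeft Rf ∘ₗ HopfAlgebra.antipode ℂ)) := by
  rw [← sweedler_assoc (m₁ := (LinearMap.mul ℂ (Module.End ℂ H)).flip)
    (m₂ := LinearMap.mul ℂ (Module.End ℂ H)), ← hR.sweedler_mulLeftHom_antipode_opLeft,
    sweedler_assoc (m₃ := LinearMap.mul ℂ (Module.End ℂ H))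
    (m₄ := LinearMap.mul ℂ _) (fun x y z => by simp [mul_assoc]),
    sweedler_counit_right (opLeft Rf 1) (fun a =>
      sweedler_of_mul_antipode (opLeft Rf) (fun x y => by simp [hR.opLeft_mul]) a)]
  · ext
    simp [hR.opLeft_one]
  · intro x y z
    simp only [LinearMap.flip_apply, LinearMap.mul_apply', LinearMap.comp_apply]
    rw [mul_assoc, ← opLeft_mul_opRight, mul_assoc]

theorem IsCotriangular.sweedler_opRight_antipode (hR : IsCotriangular Rf) :
    sweedler (LinearMap.mul ℂ (Module.End ℂ H)).flip (opRight Rf ∘ₗ HopfAlgebra.antipode ℂ)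
        (mulLeftHom ∘ₗ HopfAlgebra.antipode ℂ) =
      sweedler (LinearMap.mul ℂ (Module.End ℂ H)) (mulRightHom ∘ₗ HopfAlgebra.antipode ℂ)
        (opLeft Rf ∘ₗ HopfAlgebra.antipode ℂ) := by
  rw [hR.mulLeftHom_antipode, ← sweedler_assoc (m₁ := (LinearMap.mul ℂ (Module.End ℂ H)).flip)
    (m₂ := (LinearMap.mul ℂ (Module.End ℂ H)).flip) (fun x y z => by simp [mul_assoc]),
    sweedler_counit_left (opRight Rf 1) (fun a =>
      sweedler_of_antipode_mul (opRight Rf) (fun x y => by simp [hR.opRight_mul]) a)]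
  ext
  simp [hR.opRight_one]

/-- The functional `u(a) = Σ R(a₂, S(a₁))` (the Drinfeld element of `(H, R)`). -/
def drinfeld (Rf : H ⊗[ℂ] H →ₗ[ℂ] ℂ) : H →ₗ[ℂ] ℂ :=
  sweedler (form Rf).flip (HopfAlgebra.antipode ℂ) LinearMap.id

/-- The operator `V(a) = Σ u(a₁) a₂`. -/
def drinfeldOp (Rf : H ⊗[ℂ] H →ₗ[ℂ] ℂ) : Module.End ℂ H :=
  sweedler (LinearMap.lsmul ℂ H) (drinfeld Rf) LinearMap.id

theorem sweedler_opLeft_antipode (Rf : H ⊗[ℂ] H →ₗ[ℂ] ℂ) :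
    sweedler (LinearMap.id : Module.End ℂ H →ₗ[ℂ] H →ₗ[ℂ] H)
      (opLeft Rf ∘ₗ HopfAlgebra.antipode ℂ) LinearMap.id = drinfeldOp Rf := by
  rw [drinfeldOp, drinfeld, sweedler_assoc (m₃ := TensorProduct.mk ℂ H H)
    (m₄ := evalLeft ∘ₗ (form Rf).flip) (fun x y z => by simp), sweedler_mk]
  exact sweedler_congr (fun x y => rfl)

/-- `Σ S(a₁) a₂ ⊗ a₃ = 1 ⊗ a`. -/
theorem sweedler_antipode_comul (a : H) :
    sweedler ((LinearMap.rTensorHom H ∘ₗ LinearMap.mul ℂ H).compl₂ Coalgebra.comul)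
      (HopfAlgebra.antipode ℂ) LinearMap.id a = 1 ⊗ₜ a := by
  have h : sweedler ((LinearMap.rTensorHom H ∘ₗ LinearMap.mul ℂ H).compl₂ Coalgebra.comul)
      (HopfAlgebra.antipode ℂ) LinearMap.id =
      sweedler (LinearMap.rTensorHom H ∘ₗ LinearMap.mul ℂ H) (HopfAlgebra.antipode ℂ)
        (Coalgebra.comul (R := ℂ)) := sweedler_congr (fun x y => rfl)
  rw [h, ← sweedler_mk, ← sweedler_assoc (m₁ := LinearMap.mul ℂ H) (m₂ := TensorProduct.mk ℂ H H)
    (fun x y z => by simp), sweedler_antipode_id, sweedler_counit_left (1 : H)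
      (fun a => by simp [Algebra.algebraMap_eq_smul_one])]
  simp

theorem mulLeftHom_comp_evalRight (f : H →ₗ[ℂ] ℂ) (x : H) :
    mulLeftHom x ∘ₗ evalRight f =
      evalRight f ∘ₗ LinearMap.rTensorHom H (LinearMap.mul ℂ H x) := by
  ext y z
  simp

theorem sweedler_opRight_mulLeftHom (Rf : H ⊗[ℂ] H →ₗ[ℂ] ℂ) (a : H) :
    sweedler (LinearMap.id : Module.End ℂ H →ₗ[ℂ] H →ₗ[ℂ] H)
      (sweedler (LinearMap.mul ℂ (Module.End ℂ H)).flip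
        (opRight Rf ∘ₗ HopfAlgebra.antipode ℂ) (mulLeftHom ∘ₗ HopfAlgebra.antipode ℂ))
      LinearMap.id a = drinfeld Rf a • 1 := by
  have h : sweedler (LinearMap.mul ℂ (Module.End ℂ H)).flip
      (opRight Rf ∘ₗ HopfAlgebra.antipode ℂ) (mulLeftHom ∘ₗ HopfAlgebra.antipode ℂ) =
      sweedler (((LinearMap.llcomp ℂ (H ⊗[ℂ] H) H H).flip.compl₂ mulLeftHom).compr₂
        (LinearMap.lcomp ℂ H Coalgebra.comul))
        ((evalRight ∘ₗ (form Rf).flip) ∘ₗ HopfAlgebra.antipode ℂ) (HopfAlgebra.antipode ℂ) :=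
    sweedler_congr (fun x y => rfl)
  rw [h, sweedler_assoc
    (m₃ := (LinearMap.rTensorHom H ∘ₗ LinearMap.mul ℂ H).compl₂ Coalgebra.comul)
    (m₄ := LinearMap.id) (fun x y z =>
      LinearMap.congr_fun (mulLeftHom_comp_evalRight _ _) (Coalgebra.comul (R := ℂ) z))]
  have h' : drinfeld Rf a • (1 : H) = (LinearMap.toSpanSingleton ℂ H 1 ∘ₗ drinfeld Rf) a := rfl
  rw [h', drinfeld, comp_sweedler (LinearMap.toSpanSingleton ℂ H 1)
      (m' := (form Rf).flip.compr₂ (LinearMap.toSpanSingleton ℂ H 1)) (fun x y => rfl)]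
  exact LinearMap.congr_fun
    (sweedler_congr (fun x y => by rw [sweedler_antipode_comul]; simp)) a

/-- `Σ V(a₂) S(a₁) = u(a) 1`. -/
theorem IsCotriangular.sweedler_antipode_drinfeldOp (hR : IsCotriangular Rf) (a : H) :
    sweedler (LinearMap.mul ℂ H).flip (HopfAlgebra.antipode ℂ) (drinfeldOp Rf) a =
      drinfeld Rf a • 1 := by
  rw [← sweedler_opRight_mulLeftHom, hR.sweedler_opRight_antipode,
    sweedler_assoc (m₃ := (LinearMap.id : Module.End ℂ H →ₗ[ℂ] H →ₗ[ℂ] H))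
      (m₄ := (LinearMap.id : Module.End ℂ H →ₗ[ℂ] H →ₗ[ℂ] H)) (fun x y z => rfl),
    sweedler_opLeft_antipode]
  exact LinearMap.congr_fun (sweedler_congr (fun x y => rfl)) a

/-- `V(a) = Σ V(a₃) S(a₂) S²(a₁)`. -/
theorem drinfeldOp_eq (Rf : H ⊗[ℂ] H →ₗ[ℂ] ℂ) :
    drinfeldOp Rf = sweedler (LinearMap.mul ℂ H).flip
      (HopfAlgebra.antipode ℂ ∘ₗ HopfAlgebra.antipode ℂ)
      (sweedler (LinearMap.mul ℂ H).flip (HopfAlgebra.antipode ℂ) (drinfeldOp Rf)) := by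
  rw [← sweedler_assoc (m₁ := (LinearMap.mul ℂ H).flip) (m₂ := (LinearMap.mul ℂ H).flip)
    (fun x y z => by simp [mul_assoc]),
    sweedler_counit_left (HopfAlgebra.antipode ℂ (1 : H)) (fun a =>
      sweedler_of_antipode_mul (HopfAlgebra.antipode ℂ)
        (fun x y => by simp [HopfAlgebra.antipode_mul_antidistrib]) a)]
  ext
  simp

/-- `a = Σ P_{a₁}(V(a₂))`. -/
theorem IsCotriangular.sweedler_opLeft_drinfeldOp (hR : IsCotriangular Rf) :
    sweedler (LinearMap.id : Module.End ℂ H →ₗ[ℂ] H →ₗ[ℂ] H) (opLeft Rf) (drinfeldOp Rf) =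
      LinearMap.id := by
  rw [← sweedler_opLeft_antipode, ← sweedler_assoc (m₁ := LinearMap.mul ℂ (Module.End ℂ H))
    (m₂ := (LinearMap.id : Module.End ℂ H →ₗ[ℂ] H →ₗ[ℂ] H)) (fun x y z => rfl),
    sweedler_counit_left (opLeft Rf 1) (fun a =>
      sweedler_of_mul_antipode (opLeft Rf) (fun x y => by simp [hR.opLeft_mul]) a)]
  ext
  simp [hR.opLeft_one]

theorem IsCotriangular.apply_antipode (hR : IsCotriangular Rf) (a b : H) :
    Rf (HopfAlgebra.antipode ℂ a ⊗ₜ b) = Rf (b ⊗ₜ a) :=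
  LinearMap.congr_fun (LinearMap.congr_fun hR.form_antipode a) b

theorem IsRForm.form_mul_eq_zero (hR : IsRForm Rf) {a : H} (ha : form Rf a = 0) (h : H) :
    form Rf (h * a) = 0 ∧ form Rf (a * h) = 0 := by
  rw [hR.form_mul, hR.form_mul, ha]
  exact ⟨LinearMap.ext (map_sweedler_eq_zero LinearMap.id fun x y => by simp),
    LinearMap.ext (map_sweedler_eq_zero LinearMap.id fun x y => by simp)⟩

/-- `R(P_x(c), a) = R(c, a x)`. -/
theorem IsRForm.apply_opLeft (hR : IsRForm Rf) (x c a : H) :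
    Rf (opLeft Rf x c ⊗ₜ a) = Rf (c ⊗ₜ (a * x)) := by
  have h : (form Rf).flip a ∘ₗ opLeft Rf x = (form Rf).flip (a * x) := by
    rw [hR.flip_form_mul, opLeft, LinearMap.comp_apply, hitLeft_eq_sweedler]
    exact comp_sweedler _ (fun y z => by simp)
  exact LinearMap.congr_fun h c

theorem IsCotriangular.mem_rad_of_form_eq_zero (hR : IsCotriangular Rf) {a : H}
    (ha : form Rf a = 0) : a ∈ rad Rf := by
  intro b
  have h : ∀ x c : H, ((form Rf).flip a ∘ₗ opLeft Rf x) (drinfeldOp Rf c) = 0 := by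
    intro x c
    rw [drinfeldOp_eq]
    refine map_sweedler_eq_zero _ (fun y z => ?_) c
    rw [hR.sweedler_antipode_drinfeldOp]
    simp only [LinearMap.flip_apply, LinearMap.mul_apply', LinearMap.comp_apply,
      one_mul, map_smul, form_apply, hR.apply_opLeft, hR.apply_antipode]
    rw [← form_apply, (hR.form_mul_eq_zero ha x).2]
    simp
  have h' := map_sweedler_eq_zero ((form Rf).flip a)
    (m := (LinearMap.id : Module.End ℂ H →ₗ[ℂ] H →ₗ[ℂ] H)) (φ := opLeft Rf)
    (ψ := drinfeldOp Rf) h b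
  rwa [hR.sweedler_opLeft_drinfeldOp] at h'

theorem IsCotriangular.mem_rad_iff (hR : IsCotriangular Rf) {a : H} :
    a ∈ rad Rf ↔ form Rf a = 0 :=
  ⟨fun h => LinearMap.ext fun b => by
    rw [form_apply, ← hR.apply_antipode, h, LinearMap.zero_apply], hR.mem_rad_of_form_eq_zero⟩

/-- If a family of functionals separates the points of `V`, then the induced maps separate the
points of `V ⊗ N`. -/
theorem eq_zero_of_forall_rTensor_eq_zero {ι V N : Type} [AddCommGroup V] [Module ℂ V]
    [AddCommGroup N] [Module ℂ N] {f : ι → V →ₗ[ℂ] ℂ} (hf : ∀ v, (∀ i, f i v = 0) → v = 0)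
    {t : V ⊗[ℂ] N} (ht : ∀ i, (f i).rTensor N t = 0) : t = 0 := by
  classical
  let b := Module.Basis.ofVectorSpace ℂ N
  have key : ∀ (i) (t : V ⊗[ℂ] N) (j),
      TensorProduct.equivFinsuppOfBasisRight b ((f i).rTensor N t) j =
        f i (TensorProduct.equivFinsuppOfBasisRight b t j) := by
    intro i t j
    induction t with
    | zero => simp
    | tmul x y => simp
    | add x y hx hy => simp [hx, hy]
  apply (TensorProduct.equivFinsuppOfBasisRight b).injective
  ext j
  rw [map_zero, Finsupp.zero_apply]
  refine hf _ fun i => ?_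
  rw [← key, ht, map_zero, Finsupp.zero_apply]

/-- The functional on `H ⧸ rad R` induced by `R(g, ·)`. -/
def quotForm (Rf : H ⊗[ℂ] H →ₗ[ℂ] ℂ) (g : H) : (H ⧸ rad Rf) →ₗ[ℂ] ℂ :=
  (rad Rf).liftQ (form Rf g) fun _ ha => ha g

theorem eq_zero_of_forall_quotForm_eq_zero (v : H ⧸ rad Rf) (h : ∀ g, quotForm Rf g v = 0) :
    v = 0 := by
  induction v using Submodule.Quotient.induction_on with
  | _ a => exact (Submodule.Quotient.mk_eq_zero _).2 h

theorem IsRForm.map_mkQ_comul (hR : IsRForm Rf) {a : H} (ha : a ∈ rad Rf) :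
    TensorProduct.map (rad Rf).mkQ (rad Rf).mkQ (Coalgebra.comul (R := ℂ) a) = 0 := by
  refine eq_zero_of_forall_rTensor_eq_zero eq_zero_of_forall_quotForm_eq_zero fun g => ?_
  apply (TensorProduct.lid ℂ (H ⧸ rad Rf)).injective
  rw [map_zero]
  refine eq_zero_of_forall_quotForm_eq_zero _ fun h => ?_
  have key : quotForm Rf h ∘ₗ (TensorProduct.lid ℂ (H ⧸ rad Rf)).toLinearMap ∘ₗ
      (quotForm Rf g).rTensor (H ⧸ rad Rf) ∘ₗ TensorProduct.map (rad Rf).mkQ (rad Rf).mkQ =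
      TensorProduct.lift ((LinearMap.mul ℂ ℂ).compl₁₂ (form Rf g) (form Rf h)) := by
    ext x y
    simp only [TensorProduct.AlgebraTensorModule.curry_apply, LinearMap.restrictScalars_self,
      TensorProduct.curry_apply, LinearMap.comp_apply, TensorProduct.map_tmul,
      LinearMap.rTensor_tmul, LinearEquiv.coe_coe, TensorProduct.lid_tmul, map_smul,
      TensorProduct.lift.tmul, LinearMap.compl₁₂_apply]
    rfl
  refine (LinearMap.congr_fun key _).trans ?_
  rw [← sweedler_apply, ← hR.form_mul]
  exact ha (g * h)

theorem IsRForm.comul_mem (hR : IsRForm Rf) {a : H} (ha : a ∈ rad Rf) :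
    Coalgebra.comul (R := ℂ) a ∈
      LinearMap.range (TensorProduct.map (rad Rf).subtype (LinearMap.id : H →ₗ[ℂ] H))
      ⊔ LinearMap.range (TensorProduct.map (LinearMap.id : H →ₗ[ℂ] H) (rad Rf).subtype) := by
  have h := TensorProduct.map_ker (LinearMap.exact_subtype_mkQ (rad Rf))
    (Submodule.mkQ_surjective _) (LinearMap.exact_subtype_mkQ (rad Rf))
    (Submodule.mkQ_surjective _)
  rw [sup_comm]
  exact h.le (hR.map_mkQ_comul ha)

/-- Let `(H,R)` be cotriangular and `I_R` the right radical of `R`.  Then `I_R` coincides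
with the left radical, and `I_R` is a Hopf ideal of `H`: a two-sided ideal which is also a
coideal (`ε(I_R) = 0` and `Δ(I_R) ⊆ I_R ⊗ H + H ⊗ I_R`) stable under the antipode. -/
theorem radical_isHopfIdeal (Rf : H ⊗[ℂ] H →ₗ[ℂ] ℂ) (hR : IsCotriangular Rf) :
    ((rad Rf : Set H) = {a : H | ∀ b : H, Rf (a ⊗ₜ[ℂ] b) = 0})
    ∧ (∀ a ∈ rad Rf, ∀ h : H, h * a ∈ rad Rf ∧ a * h ∈ rad Rf)
    ∧ (∀ a ∈ rad Rf, Coalgebra.counit a = (0 : ℂ))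
    ∧ (∀ a ∈ rad Rf, Coalgebra.comul (R := ℂ) a ∈
        LinearMap.range (TensorProduct.map (rad Rf).subtype LinearMap.id)
        ⊔ LinearMap.range (TensorProduct.map LinearMap.id (rad Rf).subtype))
    ∧ (∀ a ∈ rad Rf, HopfAlgebra.antipode (R := ℂ) a ∈ rad Rf) := by
  refine ⟨Set.ext fun a => ?_, fun a ha h => ?_, fun a ha => ?_, fun a ha => hR.comul_mem ha,
    fun a ha => ?_⟩
  · exact hR.mem_rad_iff.trans LinearMap.ext_iff
  · rw [hR.mem_rad_iff] at ha ⊢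
    rw [hR.mem_rad_iff]
    exact hR.form_mul_eq_zero ha h
  · rw [← hR.form_one]
    exact ha 1
  · rw [hR.mem_rad_iff]
    ext b
    rw [form_apply, hR.apply_antipode, ha, LinearMap.zero_apply]
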